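/- Let n ∈ ℕ, s ∈ (1,∞)\ℕ with s ∈ (1, n+[s]+1), and let A be a Young function. If φ is an admissible function and c > 0 is a constant such that |u|_{𝓛^{[s],φ}(ℝⁿ)} ≤ c |∇^{[s]}u|_{{s},A,ℝⁿ} for every u ∈ V^{s,A}(ℝⁿ), then there exists a constant c' > 0 such that ψ^{[s]}_{s,A}(r) = r^{{s}} A⁻¹(r^{−n}) ≤ c' φ(r) for all r > 0. Hence 𝓛^{[s],ψ^{[s]}_{s,A}}(ℝⁿ) is the optimal [s]-th order Campanato target space for V^{s,A}(ℝⁿ). -/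

import Mathlib

open MeasureTheory Metric Set Filter
open scoped ENNReal Topology

noncomputable section

/-- Euclidean space `ℝⁿ`. -/
abbrev Euc (n : ℕ) := EuclideanSpace ℝ (Fin n)

/-- A Young function: convex, left-continuous, vanishing at `0`,
non-constant on `(0,∞)`, with values in `[0,∞]`. -/
def IsYoung (A : ℝ → ℝ≥0∞) : Prop :=
  A 0 = 0 ∧
  (∀ x y t : ℝ, 0 ≤ x → 0 ≤ y → 0 ≤ t → t ≤ 1 →
      A (t * x + (1 - t) * y) ≤ ENNReal.ofReal t * A x + ENNReal.ofReal (1 - t) * A y) ∧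
  (∀ t : ℝ, 0 < t → ContinuousWithinAt A (Set.Iic t) t) ∧
  (∃ t₁ t₂ : ℝ, 0 < t₁ ∧ 0 < t₂ ∧ A t₁ ≠ A t₂)

/-- The right-continuous generalized inverse of a monotone function `A : [0,∞) → [0,∞]`. -/
def rcInv (A : ℝ → ℝ≥0∞) (v : ℝ≥0∞) : ℝ :=
  sInf {τ : ℝ | 0 ≤ τ ∧ v < A τ}

/-- The Young conjugate `Ã(t) = sup {τ t - A(τ) : τ ≥ 0}`. -/
def youngConj (A : ℝ → ℝ≥0∞) (t : ℝ) : ℝ≥0∞ :=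
  ⨆ (τ : ℝ) (_ : 0 ≤ τ), ENNReal.ofReal (τ * t) - A τ

/-- The functional `J_{σ,A}(v)` for a vector-valued `v`, with the Euclidean norm. -/
def Jfun (n : ℕ) (σ : ℝ) (A : ℝ → ℝ≥0∞) {ι : Type} [Fintype ι]
    (v : Euc n → ι → ℝ) : ℝ≥0∞ :=
  ∫⁻ x : Euc n, ∫⁻ y : Euc n,
    A (Real.sqrt (∑ i, (v x i - v y i) ^ 2) / ‖x - y‖ ^ σ) /
      ENNReal.ofReal (‖x - y‖ ^ (n : ℝ))

/-- The fractional Orlicz–Sobolev seminorm `|v|_{σ,A,ℝⁿ}` (vector-valued version). -/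
def fracSem (n : ℕ) (σ : ℝ) (A : ℝ → ℝ≥0∞) {ι : Type} [Fintype ι]
    (v : Euc n → ι → ℝ) : ℝ≥0∞ :=
  sInf (ENNReal.ofReal '' {lam : ℝ | 0 < lam ∧ Jfun n σ A (fun x i => v x i / lam) ≤ 1})

/-- The fractional Orlicz–Sobolev seminorm `|u|_{σ,A,ℝⁿ}` of a scalar function. -/
def fracSemS (n : ℕ) (σ : ℝ) (A : ℝ → ℝ≥0∞) (u : Euc n → ℝ) : ℝ≥0∞ :=
  fracSem n σ A (fun x (_ : Fin 1) => u x)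

/-- The normalized mean oscillation `φ(|B|^{1/n})⁻¹ ⨍_B |u - u_B|` over the ball `B = B(x,r)`. -/
def oscQuot (n : ℕ) (φ : ℝ → ℝ) (u : Euc n → ℝ) (x : Euc n) (r : ℝ) : ℝ :=
  (φ ((volume (ball x r)).toReal ^ ((n : ℝ)⁻¹)))⁻¹ *
    ⨍ y in ball x r, |u y - ⨍ z in ball x r, u z|

/-- The Campanato seminorm `|u|_{𝓛^φ(ℝⁿ)}`. -/
def campSem (n : ℕ) (φ : ℝ → ℝ) (u : Euc n → ℝ) : ℝ≥0∞ :=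
  ⨆ (x : Euc n) (r : ℝ) (_ : 0 < r), ENNReal.ofReal (oscQuot n φ u x r)

/-- The Campanato quantity restricted to balls of measure at most `r`. -/
def campSemSmall (n : ℕ) (φ : ℝ → ℝ) (u : Euc n → ℝ) (r : ℝ) : ℝ≥0∞ :=
  ⨆ (x : Euc n) (ρ : ℝ) (_ : 0 < ρ) (_ : volume (ball x ρ) ≤ ENNReal.ofReal r),
    ENNReal.ofReal (oscQuot n φ u x ρ)

/-- `φ : (0,∞) → (0,∞)` is admissible: positive and bounded below away from zero on `[a,∞)`. -/
def Admissible (φ : ℝ → ℝ) : Prop :=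
  (∀ r : ℝ, 0 < r → 0 < φ r) ∧
  ∀ a : ℝ, 0 < a → ∃ ε : ℝ, 0 < ε ∧ ∀ r : ℝ, a ≤ r → ε ≤ φ r

/-- `φ_{s,A}(r) = r^s A⁻¹(r^{-n})`. -/
def phiSA (n : ℕ) (s : ℝ) (A : ℝ → ℝ≥0∞) (r : ℝ) : ℝ :=
  r ^ s * rcInv A (ENNReal.ofReal (r ^ (-(n : ℝ))))

/-- `u` is `m`-times weakly differentiable, with iterated weak partial
derivatives recorded by `D`. -/
def HasWeakDerivs (n m : ℕ) (u : Euc n → ℝ)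
    (D : (h : ℕ) → Euc n → (Fin h → Fin n) → ℝ) : Prop :=
  (∀ x d, D 0 x d = u x) ∧
  ∀ h : ℕ, h ≤ m → ∀ dirs : Fin h → Fin n,
    LocallyIntegrable (fun x => D h x dirs) volume ∧
    ∀ φ : Euc n → ℝ, ContDiff ℝ (⊤ : ℕ∞) φ → HasCompactSupport φ →
      ∫ x : Euc n, u x *
          iteratedFDeriv ℝ h φ x (fun i => EuclideanSpace.single (dirs i) (1 : ℝ)) =
        (-1 : ℝ) ^ h * ∫ x : Euc n, D h x dirs * φ x

/-- The Euclidean length `|∇^h u|(x)` of the `h`-th order weak gradient. -/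
def gradLen (n : ℕ) (D : (h : ℕ) → Euc n → (Fin h → Fin n) → ℝ) (h : ℕ) (x : Euc n) : ℝ :=
  Real.sqrt (∑ d : Fin h → Fin n, (D h x d) ^ 2)

/-- The derivatives of orders `k, …, m` decay near infinity:
`|{|∇^h u| > t}| < ∞` for every `t > 0`. -/
def DecayFrom (n k m : ℕ) (D : (h : ℕ) → Euc n → (Fin h → Fin n) → ℝ) : Prop :=
  ∀ h : ℕ, k ≤ h → h ≤ m → ∀ t : ℝ, 0 < t →
    volume {x : Euc n | t < gradLen n D h x} < ⊤

/-- The Young function `F_k(t) = t^{n/(n-s+k+1)} ∫_0^t Ã(τ) τ^{-1-n/(n-s+k+1)} dτ`. -/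
def Fk (n : ℕ) (s : ℝ) (k : ℕ) (A : ℝ → ℝ≥0∞) (t : ℝ) : ℝ≥0∞ :=
  ENNReal.ofReal (t ^ ((n : ℝ) / ((n : ℝ) - s + (k : ℝ) + 1))) *
    ∫⁻ τ in Set.Ioc (0 : ℝ) t,
      youngConj A τ * ENNReal.ofReal (τ ^ (-1 - (n : ℝ) / ((n : ℝ) - s + (k : ℝ) + 1)))

/-- `ψ^k_{s,A}(r) = 1 / (r^{n-s+k} F_k⁻¹(r^{-n}))`. -/
def psiK (n : ℕ) (s : ℝ) (k : ℕ) (A : ℝ → ℝ≥0∞) (r : ℝ) : ℝ :=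
  (r ^ ((n : ℝ) - s + (k : ℝ)) * rcInv (Fk n s k A) (ENNReal.ofReal (r ^ (-(n : ℝ)))))⁻¹

/-- `ψ^{[s]}_{s,A}(r) = r^{{s}} A⁻¹(r^{-n})`. -/
def psiTop (n : ℕ) (s : ℝ) (A : ℝ → ℝ≥0∞) (r : ℝ) : ℝ :=
  r ^ (s - (⌊s⌋₊ : ℝ)) * rcInv A (ENNReal.ofReal (r ^ (-(n : ℝ))))

/-- Convergence near zero of `∫_0 (t/A(t))^{(s-(k+1))/(n-(s-(k+1)))} dt`. -/
def IntCondK (n : ℕ) (s : ℝ) (k : ℕ) (A : ℝ → ℝ≥0∞) : Prop :=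
  ∃ ε : ℝ, 0 < ε ∧
    ∫⁻ t in Set.Ioc (0 : ℝ) ε,
      (ENNReal.ofReal t / A t) ^ ((s - (k : ℝ) - 1) / ((n : ℝ) - (s - (k : ℝ) - 1))) < ⊤

/-- `P` is the projection polynomial `P^k_B[u]`: it has degree at most `k` and its
derivatives up to order `k` match, in the mean over `B`, the weak derivatives `D` of `u`. -/
def IsCampPoly (n k : ℕ) (D : (h : ℕ) → Euc n → (Fin h → Fin n) → ℝ)
    (B : Set (Euc n)) (P : MvPolynomial (Fin n) ℝ) : Prop :=
  P.totalDegree ≤ k ∧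
  ∀ h : ℕ, h ≤ k → ∀ dirs : Fin h → Fin n,
    ∫ x in B, D h x dirs =
      ∫ x in B,
        iteratedFDeriv ℝ h (fun y : Euc n => MvPolynomial.eval (fun i => y i) P) x
          (fun i => EuclideanSpace.single (dirs i) (1 : ℝ))

/-- The normalized oscillation of order `k` over the ball `B(x,r)`. -/
def oscQuotK (n k : ℕ) (φ : ℝ → ℝ) (u : Euc n → ℝ)
    (D : (h : ℕ) → Euc n → (Fin h → Fin n) → ℝ) (x : Euc n) (r : ℝ) : ℝ≥0∞ :=
  ⨅ (P : MvPolynomial (Fin n) ℝ) (_ : IsCampPoly n k D (ball x r) P),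
    ENNReal.ofReal
      ((φ ((volume (ball x r)).toReal ^ ((n : ℝ)⁻¹)) *
          (volume (ball x r)).toReal ^ ((k : ℝ) / (n : ℝ)))⁻¹ *
        ⨍ y in ball x r, |u y - MvPolynomial.eval (fun i => y i) P|)

/-- The `k`-th order Campanato seminorm `|u|_{𝓛^{k,φ}(ℝⁿ)}`. -/
def campSemK (n k : ℕ) (φ : ℝ → ℝ) (u : Euc n → ℝ)
    (D : (h : ℕ) → Euc n → (Fin h → Fin n) → ℝ) : ℝ≥0∞ :=
  ⨆ (x : Euc n) (r : ℝ) (_ : 0 < r), oscQuotK n k φ u D x r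

/-- The `k`-th order Campanato quantity restricted to balls of measure at most `r`. -/
def campSemKSmall (n k : ℕ) (φ : ℝ → ℝ) (u : Euc n → ℝ)
    (D : (h : ℕ) → Euc n → (Fin h → Fin n) → ℝ) (r : ℝ) : ℝ≥0∞ :=
  ⨆ (x : Euc n) (ρ : ℝ) (_ : 0 < ρ) (_ : volume (ball x ρ) ≤ ENNReal.ofReal r),
    oscQuotK n k φ u D x ρ

/-- The Luxemburg norm `‖f‖_{L^A(μ)}`. -/
def luxNorm {α : Type*} [MeasurableSpace α] (A : ℝ → ℝ≥0∞) (μ : Measure α)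
    (f : α → ℝ) : ℝ≥0∞ :=
  sInf (ENNReal.ofReal '' {lam : ℝ | 0 < lam ∧ ∫⁻ x, A (|f x| / lam) ∂μ ≤ 1})

/-- Iterated integral `∫_r^∞ ∫_{r_1}^∞ ⋯ g`. -/
def iterInt : ℕ → (ℝ → ℝ) → (ℝ → ℝ)
  | 0, g => g
  | j + 1, g => fun r => ∫ t in Set.Ioi r, iterInt j g t

end

/-- Iterated partial derivatives `∂_{d (h-1)} ⋯ ∂_{d 0} u`, the derivative along `d 0` being
taken first. -/
noncomputable def iterPartial (n : ℕ) : (h : ℕ) → (Euc n → ℝ) → (Fin h → Fin n) → Euc n → ℝ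
  | 0, u, _ => u
  | h + 1, u, d =>
      iterPartial n h (fun y => fderiv ℝ u y (EuclideanSpace.single (d 0) (1 : ℝ))) (Fin.tail d)

theorem contDiff_iterPartial (n h : ℕ) (u : Euc n → ℝ) (hu : ContDiff ℝ (⊤ : ℕ∞) u)
    (d : Fin h → Fin n) : ContDiff ℝ (⊤ : ℕ∞) (iterPartial n h u d) := by
  induction h generalizing u with
  | zero => exact hu
  | succ h ih =>
    exact ih _ ((hu.fderiv_right (m := (⊤ : ℕ∞)) le_rfl).clm_apply contDiff_const) _

theorem tsupport_iterPartial_subset (n h : ℕ) (u : Euc n → ℝ) (d : Fin h → Fin n) :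
    tsupport (iterPartial n h u d) ⊆ tsupport u := by
  induction h generalizing u with
  | zero => exact subset_rfl
  | succ h ih => exact (ih _ _).trans (tsupport_fderiv_apply_subset ℝ _)

theorem hasCompactSupport_iterPartial (n h : ℕ) (u : Euc n → ℝ) (hu : HasCompactSupport u)
    (d : Fin h → Fin n) : HasCompactSupport (iterPartial n h u d) :=
  hu.of_isClosed_subset (isClosed_tsupport _) (tsupport_iterPartial_subset n h u d)

theorem iterPartial_comp_smul (n h : ℕ) (w : Euc n → ℝ) (hw : ContDiff ℝ (⊤ : ℕ∞) w) (a b : ℝ)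
    (d : Fin h → Fin n) (x : Euc n) :
    iterPartial n h (fun y => a * w (b • y)) d x = a * b ^ h * iterPartial n h w d (b • x) := by
  induction h generalizing w a with
  | zero => simp [iterPartial]
  | succ h ih =>
    have hstep : (fun y : Euc n => fderiv ℝ (fun y => a * w (b • y)) y
        (EuclideanSpace.single (d 0) (1 : ℝ))) =
        fun y => (a * b) * (fun z => fderiv ℝ w z (EuclideanSpace.single (d 0) (1 : ℝ))) (b • y) := by
      funext y
      have hd : DifferentiableAt ℝ w (b • y) := (hw.differentiable (by simp)).differentiableAt
      have h1 : HasFDerivAt (fun y : Euc n => b • y) (b • ContinuousLinearMap.id ℝ (Euc n)) y :=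
        (hasFDerivAt_id y).const_smul b
      have h2 := (hd.hasFDerivAt.comp y h1).const_mul a
      have h3 : fderiv ℝ (fun y => a * w (b • y)) y = _ := h2.fderiv
      rw [h3]
      simp
      ring
    simp only [iterPartial]
    rw [hstep, ih _ ((hw.fderiv_right (m := (⊤ : ℕ∞)) le_rfl).clm_apply contDiff_const)]
    ring

theorem integral_mul_iteratedFDeriv_eq (n h : ℕ) (u φ : Euc n → ℝ)
    (hu : ContDiff ℝ (⊤ : ℕ∞) u) (hφ : ContDiff ℝ (⊤ : ℕ∞) φ)
    (huc : HasCompactSupport u) (d : Fin h → Fin n) :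
    ∫ x : Euc n, u x *
        iteratedFDeriv ℝ h φ x (fun i => EuclideanSpace.single (d i) (1 : ℝ)) =
      (-1 : ℝ) ^ h * ∫ x : Euc n, iterPartial n h u d x * φ x := by
  induction h generalizing u with
  | zero => simp [iterPartial]
  | succ h ih =>
    set e : Euc n := EuclideanSpace.single (d 0) (1 : ℝ)
    set g : Euc n → ℝ := fun x => iteratedFDeriv ℝ h φ x
      (fun i => EuclideanSpace.single (Fin.tail d i) (1 : ℝ)) with hg
    have hit : ContDiff ℝ (⊤ : ℕ∞) (iteratedFDeriv ℝ h φ) :=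
      hφ.iteratedFDeriv_right (m := (⊤ : ℕ∞)) (by norm_cast)
    have hgs : ContDiff ℝ (⊤ : ℕ∞) g :=
      (ContinuousMultilinearMap.apply ℝ (fun _ : Fin h => Euc n) ℝ _).contDiff.comp hit
    have hus : ContDiff ℝ (⊤ : ℕ∞) (fun x => fderiv ℝ u x e) :=
      (hu.fderiv_right (m := (⊤ : ℕ∞)) le_rfl).clm_apply contDiff_const
    have hgs' : ContDiff ℝ (⊤ : ℕ∞) (fun x => fderiv ℝ g x e) :=
      (hgs.fderiv_right (m := (⊤ : ℕ∞)) le_rfl).clm_apply contDiff_const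
    have husc : HasCompactSupport (fun x => fderiv ℝ u x e) := huc.fderiv_apply ℝ e
    have hleft : ∀ x, iteratedFDeriv ℝ (h + 1) φ x
        (fun i => EuclideanSpace.single (d i) (1 : ℝ)) = fderiv ℝ g x e := by
      intro x
      rw [iteratedFDeriv_succ_apply_left]
      have h1 : HasFDerivAt (iteratedFDeriv ℝ h φ) _ x :=
        (hit.differentiable (by simp) x).hasFDerivAt
      have h2 := (ContinuousMultilinearMap.apply ℝ (fun _ : Fin h => Euc n) ℝ
        (fun i => EuclideanSpace.single (Fin.tail d i) (1 : ℝ))).hasFDerivAt.comp x h1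
      have h3 : fderiv ℝ g x = _ := h2.fderiv
      rw [h3]
      rfl
    simp_rw [hleft]
    rw [integral_mul_fderiv_eq_neg_fderiv_mul_of_integrable]
    · have := ih (fun x => fderiv ℝ u x e) hus husc (Fin.tail d)
      simp only [iterPartial]
      rw [hg, this]
      ring
    · exact (hus.continuous.mul hgs.continuous).integrable_of_hasCompactSupport husc.mul_right
    · exact (hu.continuous.mul hgs'.continuous).integrable_of_hasCompactSupport huc.mul_right
    · exact (hu.continuous.mul hgs.continuous).integrable_of_hasCompactSupport huc.mul_right
    · exact fun x _ => hu.differentiable (by simp) x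
    · exact fun x _ => hgs.differentiable (by simp) x

theorem hasWeakDerivs_iterPartial (n m : ℕ) (u : Euc n → ℝ) (hu : ContDiff ℝ (⊤ : ℕ∞) u)
    (huc : HasCompactSupport u) :
    HasWeakDerivs n m u (fun h x d => iterPartial n h u d x) :=
  ⟨fun _ _ => rfl, fun h _ d =>
    ⟨(contDiff_iterPartial n h u hu d).continuous.locallyIntegrable,
      fun φ hφ _ => integral_mul_iteratedFDeriv_eq n h u φ hu hφ huc d⟩⟩

theorem sum_choose_mul_eval_line_eq_zero (n m : ℕ) (P : MvPolynomial (Fin n) ℝ)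
    (hP : P.totalDegree ≤ m) (x v : Euc n) :
    ∑ j ∈ Finset.range (m + 2), ((-1 : ℝ) ^ (m + 1 - j) * ((m + 1).choose j : ℝ)) *
      MvPolynomial.eval (fun i => (x + (j : ℝ) • v) i) P = 0 := by
  set f : Fin n → Polynomial ℝ := fun i => Polynomial.C (x i) + Polynomial.C (v i) * Polynomial.X
  have hdeg : (MvPolynomial.aeval f P).natDegree < m + 1 := by
    have := MvPolynomial.aeval_natDegree_le P hP f (n := 1) (fun i => by
      simp only [f]; compute_degree)
    omega
  have h := congrFun (Polynomial.fwdDiff_iter_eq_zero_of_degree_lt hdeg) 0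
  rw [fwdDiff_iter_eq_sum_shift] at h
  refine Eq.trans (Finset.sum_congr rfl fun j _ => ?_) h
  have : Polynomial.eval (0 + j • (1 : ℝ)) (MvPolynomial.aeval f P) =
      MvPolynomial.eval (fun i => (x + (j : ℝ) • v) i) P := by
    rw [← Polynomial.coe_evalRingHom, MvPolynomial.aeval_def, MvPolynomial.hom_eval₂,
      MvPolynomial.eval]
    simp only [MvPolynomial.coe_eval₂Hom]
    congr 1
    · ext; simp
    · funext i; simp [f]; ring
  rw [this]
  simp

/-- A function which is constant on a ball and vanishes on the translates of the ball by the
multiples of `v` is uniformly far from polynomials in mean. -/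
theorem le_setIntegral_abs_sub_eval (n m : ℕ) (u : Euc n → ℝ) (hu : Continuous u)
    (P : MvPolynomial (Fin n) ℝ) (hP : P.totalDegree ≤ m) (v : Euc n) (lam ρ R : ℝ)
    (hlam : ∀ x ∈ ball (0 : Euc n) ρ, u x = lam)
    (hzero : ∀ x ∈ ball (0 : Euc n) ρ, ∀ j : ℕ, 1 ≤ j → u (x + (j : ℝ) • v) = 0)
    (hsub : ∀ x ∈ ball (0 : Euc n) ρ, ∀ j : ℕ, j ≤ m + 1 → x + (j : ℝ) • v ∈ ball (0 : Euc n) R) :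
    lam * (volume (ball (0 : Euc n) ρ)).toReal ≤
      2 ^ (m + 1) * ∫ y in ball (0 : Euc n) R, |u y - MvPolynomial.eval (fun i => y i) P| := by
  set F : Euc n → ℝ := fun y => |u y - MvPolynomial.eval (fun i => y i) P| with hF
  have hFc : Continuous F := by
    refine (hu.sub ?_).abs
    exact (MvPolynomial.continuous_eval P).comp (by fun_prop)
  have hint : ∀ r, IntegrableOn F (ball (0 : Euc n) r) := fun r =>
    (hFc.continuousOn.integrableOn_compact (isCompact_closedBall 0 r)).mono_set
      ball_subset_closedBall
  have hintj : ∀ j : ℕ, IntegrableOn (fun x => F (x + (j : ℝ) • v)) (ball (0 : Euc n) ρ) := fun j =>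
    ((hFc.comp (continuous_add_const _)).continuousOn.integrableOn_compact
      (isCompact_closedBall 0 ρ)).mono_set ball_subset_closedBall
  have hpt : ∀ x ∈ ball (0 : Euc n) ρ,
      lam ≤ ∑ j ∈ Finset.range (m + 2), ((m + 1).choose j : ℝ) * F (x + (j : ℝ) • v) := by
    intro x hx
    have h0 := sum_choose_mul_eval_line_eq_zero n m P hP x v
    have h1 : ∑ j ∈ Finset.range (m + 2), ((-1 : ℝ) ^ (m + 1 - j) * ((m + 1).choose j : ℝ)) *
        u (x + (j : ℝ) • v) = (-1) ^ (m + 1) * lam := by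
      rw [Finset.sum_eq_single 0]
      · simp [hlam x hx]
      · intro j _ hj
        rw [hzero x hx j (by omega), mul_zero]
      · simp
    have h2 : (-1 : ℝ) ^ (m + 1) * lam =
        ∑ j ∈ Finset.range (m + 2), ((-1 : ℝ) ^ (m + 1 - j) * ((m + 1).choose j : ℝ)) *
        (u (x + (j : ℝ) • v) - MvPolynomial.eval (fun i => (x + (j : ℝ) • v) i) P) := by
      simp only [mul_sub, Finset.sum_sub_distrib]
      rw [h0, h1, sub_zero]
    calc lam ≤ |(-1 : ℝ) ^ (m + 1) * lam| := by
          rw [abs_mul, abs_pow]; simp [le_abs_self]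
      _ ≤ _ := by
          rw [h2]
          refine (Finset.abs_sum_le_sum_abs _ _).trans (le_of_eq ?_)
          refine Finset.sum_congr rfl fun j _ => ?_
          rw [abs_mul, abs_mul, abs_pow]
          simp [hF]
  have htrans : ∀ j ∈ Finset.range (m + 2), ∫ x in ball (0 : Euc n) ρ, F (x + (j : ℝ) • v) ≤
      ∫ y in ball (0 : Euc n) R, F y := by
    intro j hj
    have hmp := measurePreserving_add_right (volume : Measure (Euc n)) ((j : ℝ) • v)
    have himg := hmp.setIntegral_image_emb (MeasurableEquiv.addRight ((j : ℝ) • v)).measurableEmbedding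
      F (ball (0 : Euc n) ρ)
    rw [← himg]
    refine setIntegral_mono_set (hint R) (Eventually.of_forall fun _ => abs_nonneg _) ?_
    refine LE.le.eventuallyLE ?_
    rintro _ ⟨x, hx, rfl⟩
    exact hsub x hx j (by have := Finset.mem_range.1 hj; omega)
  calc lam * (volume (ball (0 : Euc n) ρ)).toReal
      = ∫ x in ball (0 : Euc n) ρ, lam := by
        simp [Measure.real, mul_comm]
    _ ≤ ∫ x in ball (0 : Euc n) ρ,
          ∑ j ∈ Finset.range (m + 2), ((m + 1).choose j : ℝ) * F (x + (j : ℝ) • v) := by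
        refine setIntegral_mono_on ?_ ?_ measurableSet_ball hpt
        · exact integrableOn_const measure_ball_lt_top.ne
        · exact integrable_finsetSum _ fun j _ => (hintj j).const_mul _
    _ = ∑ j ∈ Finset.range (m + 2), ((m + 1).choose j : ℝ) *
          ∫ x in ball (0 : Euc n) ρ, F (x + (j : ℝ) • v) := by
        rw [integral_finsetSum _ fun j _ => (hintj j).const_mul _]
        simp only [integral_const_mul]
    _ ≤ ∑ j ∈ Finset.range (m + 2), ((m + 1).choose j : ℝ) * ∫ y in ball (0 : Euc n) R, F y := by
        gcongr with j hj
        exact htrans j hj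
    _ = _ := by
        rw [← Finset.sum_mul]
        congr 1
        exact_mod_cast Nat.sum_range_choose (m + 1)

/-- The kernel `min(|z|,1) |z|^{-σ-n}`. -/
noncomputable def gagKernel (n : ℕ) (σ : ℝ) (z : Euc n) : ℝ≥0∞ :=
  ENNReal.ofReal (min ‖z‖ 1 * ‖z‖ ^ (-σ - (n : ℝ)))

theorem measurable_gagKernel (n : ℕ) (σ : ℝ) : Measurable (gagKernel n σ) := by
  unfold gagKernel
  fun_prop

theorem lintegral_gagKernel_lt_top (n : ℕ) (hn : 0 < n) (σ : ℝ) (hσ0 : 0 < σ) (hσ1 : σ < 1) :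
    ∫⁻ z, gagKernel n σ z < ⊤ := by
  have : NeZero n := ⟨hn.ne'⟩
  have hint : Integrable (fun z : Euc n => (fun t : ℝ => min t 1 * t ^ (-σ - (n : ℝ))) ‖z‖) := by
    rw [integrable_fun_norm_addHaar volume (f := fun t : ℝ => min t 1 * t ^ (-σ - (n : ℝ))),
      finrank_euclideanSpace_fin, ← Ioc_union_Ioi_eq_Ioi (zero_le_one (α := ℝ)),
      integrableOn_union]
    have hpow : ∀ y : ℝ, 0 < y → y ^ (n - 1) * y ^ (-σ - (n : ℝ)) = y ^ (-σ - 1) := by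
      intro y hy
      rw [← Real.rpow_natCast, ← Real.rpow_add hy, Nat.cast_sub hn]
      congr 1
      push_cast
      ring
    constructor
    · have h : IntegrableOn (fun y : ℝ => y ^ (-σ)) (Ioc 0 1) :=
        (intervalIntegrable_iff_integrableOn_Ioc_of_le zero_le_one).1
          (intervalIntegral.intervalIntegrable_rpow' (by linarith))
      refine h.congr_fun (fun y hy => ?_) measurableSet_Ioc
      have hy0 : 0 < y := hy.1
      simp only [smul_eq_mul, min_eq_left hy.2]
      rw [mul_left_comm, hpow y hy0, mul_comm, ← Real.rpow_add_one hy0.ne']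
      congr 1
      ring
    · have h : IntegrableOn (fun y : ℝ => y ^ (-σ - 1)) (Ioi 1) :=
        integrableOn_Ioi_rpow_of_lt (by linarith) zero_lt_one
      refine h.congr_fun (fun y hy => ?_) measurableSet_Ioi
      have hy1 : (1 : ℝ) < y := hy
      simp only [smul_eq_mul, min_eq_right hy1.le, one_mul]
      rw [hpow y (by linarith)]
  exact hint.lintegral_lt_top

theorem lintegral_comp_inv_smul (n : ℕ) (ρ : ℝ) (hρ : 0 < ρ) (f : Euc n → ℝ≥0∞)
    (hf : Measurable f) :
    ∫⁻ x, f (ρ⁻¹ • x) = ENNReal.ofReal (ρ ^ n) * ∫⁻ x, f x := by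
  have hmap := Measure.map_addHaar_smul (volume : Measure (Euc n)) (inv_ne_zero hρ.ne')
  rw [← lintegral_map hf (by fun_prop : Measurable fun x : Euc n => ρ⁻¹ • x), hmap,
    lintegral_smul_measure, finrank_euclideanSpace_fin, inv_pow, inv_inv,
    abs_of_pos (pow_pos hρ n), smul_eq_mul]

/-- The symmetrized kernel on pairs of points at least one of which lies in `B`. -/
noncomputable def pairKernel (n : ℕ) (σ : ℝ) (B : Set (Euc n)) (x y : Euc n) : ℝ≥0∞ :=
  (B.indicator 1 x + B.indicator 1 y) * gagKernel n σ (x - y)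

theorem measurable_pairKernel (n : ℕ) (σ : ℝ) {B : Set (Euc n)} (hB : MeasurableSet B) :
    Measurable fun p : Euc n × Euc n => pairKernel n σ B p.1 p.2 := by
  have h1 : Measurable (B.indicator (1 : Euc n → ℝ≥0∞)) := measurable_one.indicator hB
  exact ((h1.comp measurable_fst).add (h1.comp measurable_snd)).mul
    ((measurable_gagKernel n σ).comp (measurable_fst.sub measurable_snd))

theorem lintegral_pairKernel (n : ℕ) (σ : ℝ) {B : Set (Euc n)} (hB : MeasurableSet B) :
    ∫⁻ x, ∫⁻ y, pairKernel n σ B x y = 2 * volume B * ∫⁻ z, gagKernel n σ z := by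
  have h1 : Measurable (B.indicator (1 : Euc n → ℝ≥0∞)) := measurable_one.indicator hB
  have hK := measurable_gagKernel n σ
  have hleft : ∀ x : Euc n, ∫⁻ y, gagKernel n σ (x - y) = ∫⁻ z, gagKernel n σ z :=
    fun x => lintegral_sub_left_eq_self _ x
  have hright : ∀ y : Euc n, ∫⁻ x, gagKernel n σ (x - y) = ∫⁻ z, gagKernel n σ z :=
    fun y => lintegral_sub_right_eq_self _ y
  have hind : ∫⁻ x, B.indicator (1 : Euc n → ℝ≥0∞) x = volume B := lintegral_indicator_one hB
  have hKl : ∀ x : Euc n, Measurable fun y => gagKernel n σ (x - y) := fun x =>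
    hK.comp (measurable_const.sub measurable_id)
  have hKr : ∀ y : Euc n, Measurable fun x => gagKernel n σ (x - y) := fun y =>
    hK.comp (measurable_id.sub measurable_const)
  have hm : Measurable fun p : Euc n × Euc n => B.indicator (1 : Euc n → ℝ≥0∞) p.2 *
      gagKernel n σ (p.1 - p.2) :=
    (h1.comp measurable_snd).mul (hK.comp (measurable_fst.sub measurable_snd))
  calc ∫⁻ x, ∫⁻ y, pairKernel n σ B x y
      = ∫⁻ x, ((B.indicator (1 : Euc n → ℝ≥0∞) x * ∫⁻ z, gagKernel n σ z) +
          ∫⁻ y, B.indicator (1 : Euc n → ℝ≥0∞) y * gagKernel n σ (x - y)) := by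
        refine lintegral_congr fun x => ?_
        simp only [pairKernel, add_mul]
        rw [lintegral_add_left ((hKl x).const_mul _), lintegral_const_mul _ (hKl x), hleft]
    _ = volume B * (∫⁻ z, gagKernel n σ z) +
          ∫⁻ y, ∫⁻ x, B.indicator (1 : Euc n → ℝ≥0∞) y * gagKernel n σ (x - y) := by
        rw [lintegral_add_left (h1.mul_const _), lintegral_mul_const _ h1, hind,
          lintegral_lintegral_swap hm.aemeasurable]
    _ = volume B * (∫⁻ z, gagKernel n σ z) + volume B * ∫⁻ z, gagKernel n σ z := by
        congr 1
        rw [← hind, ← lintegral_mul_const _ h1]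
        refine lintegral_congr fun y => ?_
        rw [lintegral_const_mul _ (hKr y), hright]
    _ = _ := by ring

theorem exists_sqrt_sum_sub_sq_le {n : ℕ} {ι : Type} [Fintype ι] (W : ι → Euc n → ℝ)
    (hW : ∀ i, ContDiff ℝ (⊤ : ℕ∞) (W i)) (hc : ∀ i, HasCompactSupport (W i)) :
    ∃ C : ℝ, 0 ≤ C ∧ ∀ x y, Real.sqrt (∑ i, (W i x - W i y) ^ 2) ≤ C * min ‖x - y‖ 1 := by
  have key : ∀ i, ∃ C : ℝ, 0 ≤ C ∧ ∀ x y, |W i x - W i y| ≤ C * min ‖x - y‖ 1 := by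
    intro i
    obtain ⟨L, hL⟩ := ContDiff.lipschitzWith_of_hasCompactSupport (hc i) (hW i) (by simp)
    obtain ⟨M, hM⟩ := (hc i).exists_bound_of_continuous (hW i).continuous
    have hM0 : 0 ≤ M := (norm_nonneg _).trans (hM 0)
    have hL0 : (0 : ℝ) ≤ L := L.2
    refine ⟨L + 2 * M, by positivity, fun x y => ?_⟩
    rcases le_total ‖x - y‖ 1 with h | h
    · rw [min_eq_left h]
      have := hL.norm_sub_le x y
      rw [Real.norm_eq_abs] at this
      nlinarith [norm_nonneg (x - y)]
    · rw [min_eq_right h]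
      have := abs_sub (W i x) (W i y)
      have h1 := hM x
      have h2 := hM y
      rw [Real.norm_eq_abs] at h1 h2
      linarith
  choose C hC0 hC using key
  refine ⟨∑ i, C i, Finset.sum_nonneg fun i _ => hC0 i, fun x y => ?_⟩
  have hsum : 0 ≤ ∑ i, |W i x - W i y| := Finset.sum_nonneg fun i _ => abs_nonneg _
  calc Real.sqrt (∑ i, (W i x - W i y) ^ 2) ≤ ∑ i, |W i x - W i y| := by
        rw [Real.sqrt_le_left hsum]
        simp_rw [← sq_abs (W _ x - W _ y)]
        exact Finset.sum_sq_le_sq_sum_of_nonneg fun i _ => abs_nonneg _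
    _ ≤ ∑ i, C i * min ‖x - y‖ 1 := Finset.sum_le_sum fun i _ => hC i x y
    _ = _ := by rw [Finset.sum_mul]

theorem Jfun_scaled_le (n : ℕ) (σ : ℝ) (hσ0 : 0 < σ) (hσ1 : σ < 1)
    {ι : Type} [Fintype ι] (W : Euc n → ι → ℝ) {B : Set (Euc n)} (hB : MeasurableSet B)
    (hsupp : ∀ x ∉ B, ∀ i, W x i = 0) (C : ℝ) (hC0 : 0 ≤ C)
    (hC : ∀ x y, Real.sqrt (∑ i, (W x i - W y i) ^ 2) ≤ C * min ‖x - y‖ 1)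
    (A : ℝ → ℝ≥0∞) (hA : IsYoung A) (V : ℝ≥0∞) (a : ℝ) (ha : 0 ≤ a) (haV : A a ≤ V)
    (ρ : ℝ) (hρ : 0 < ρ) (Λ : ℝ) (hΛ : 0 < Λ) (hCΛ : C ≤ Λ) :
    Jfun n σ A (fun x i => a * ρ ^ σ * W (ρ⁻¹ • x) i / Λ) ≤
      ENNReal.ofReal (C / Λ) * V * ENNReal.ofReal (ρ ^ n) *
        (2 * volume B * ∫⁻ z, gagKernel n σ z) := by
  have hpt : ∀ x y : Euc n,
      A (Real.sqrt (∑ i, (a * ρ ^ σ * W (ρ⁻¹ • x) i / Λ - a * ρ ^ σ * W (ρ⁻¹ • y) i / Λ) ^ 2) /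
        ‖x - y‖ ^ σ) / ENNReal.ofReal (‖x - y‖ ^ (n : ℝ)) ≤
      (ENNReal.ofReal (C / Λ) * V * ENNReal.ofReal ((ρ ^ n)⁻¹)) *
        pairKernel n σ B (ρ⁻¹ • x) (ρ⁻¹ • y) := by
    intro x y
    set g := Real.sqrt (∑ i, (W (ρ⁻¹ • x) i - W (ρ⁻¹ • y) i) ^ 2) with hg
    have hg0 : 0 ≤ g := Real.sqrt_nonneg _
    set δ := ‖ρ⁻¹ • x - ρ⁻¹ • y‖ with hδ
    have hρσ : 0 < ρ ^ σ := Real.rpow_pos_of_pos hρ σ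
    have hsqrt : Real.sqrt (∑ i, (a * ρ ^ σ * W (ρ⁻¹ • x) i / Λ -
        a * ρ ^ σ * W (ρ⁻¹ • y) i / Λ) ^ 2) = a * ρ ^ σ / Λ * g := by
      have : ∀ i, (a * ρ ^ σ * W (ρ⁻¹ • x) i / Λ - a * ρ ^ σ * W (ρ⁻¹ • y) i / Λ) ^ 2 =
          (a * ρ ^ σ / Λ) ^ 2 * (W (ρ⁻¹ • x) i - W (ρ⁻¹ • y) i) ^ 2 := fun i => by ring
      simp_rw [this]
      rw [← Finset.mul_sum, Real.sqrt_mul (sq_nonneg _), Real.sqrt_sq (by positivity)]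
    have hxy : ‖x - y‖ = ρ * δ := by
      rw [hδ, ← smul_sub, norm_smul, Real.norm_eq_abs, abs_of_pos (inv_pos.2 hρ)]
      field_simp
    rw [hsqrt, hxy]
    by_cases hg00 : g = 0
    · rw [hg00, mul_zero, zero_div, hA.1, ENNReal.zero_div]
      exact bot_le
    have hδ0 : 0 < δ := by
      refine lt_of_le_of_ne (norm_nonneg _) fun h => hg00 ?_
      have := hC (ρ⁻¹ • x) (ρ⁻¹ • y)
      rw [← hg, ← hδ, ← h] at this
      simp at this
      linarith
    have hmem : ρ⁻¹ • x ∈ B ∨ ρ⁻¹ • y ∈ B := by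
      by_contra! hcon
      refine hg00 ?_
      rw [hg]
      simp [hsupp _ hcon.1, hsupp _ hcon.2]
    have hker : gagKernel n σ (ρ⁻¹ • x - ρ⁻¹ • y) ≤ pairKernel n σ B (ρ⁻¹ • x) (ρ⁻¹ • y) := by
      unfold pairKernel
      refine le_mul_of_one_le_left' ?_
      rcases hmem with h | h <;> simp [h]
    have hδσ : 0 < δ ^ σ := Real.rpow_pos_of_pos hδ0 σ
    have hmin : min δ 1 ≤ δ ^ σ := by
      rcases le_total δ 1 with h | h
      · rw [min_eq_left h]
        simpa using Real.rpow_le_rpow_of_exponent_ge hδ0 h hσ1.le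
      · rw [min_eq_right h]
        exact Real.one_le_rpow h hσ0.le
    have hgC : g ≤ C * min δ 1 := hC _ _
    set θ := g / (δ ^ σ * Λ) with hθ
    have hθ0 : 0 ≤ θ := by positivity
    have hθ1 : θ ≤ 1 := by
      rw [hθ, div_le_one (by positivity)]
      calc g ≤ C * min δ 1 := hgC
        _ ≤ Λ * δ ^ σ := by gcongr
        _ = _ := mul_comm _ _
    have hθle : θ ≤ C / Λ * (min δ 1 * δ ^ (-σ)) := by
      rw [hθ, Real.rpow_neg hδ0.le, div_le_iff₀ (by positivity)]
      calc g ≤ C * min δ 1 := hgC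
        _ = _ := by field_simp
    have harg : a * ρ ^ σ / Λ * g / (ρ * δ) ^ σ = θ * a + (1 - θ) * 0 := by
      rw [Real.mul_rpow hρ.le hδ0.le, hθ]
      field_simp
      ring
    have hconv : A (a * ρ ^ σ / Λ * g / (ρ * δ) ^ σ) ≤ ENNReal.ofReal θ * V := by
      rw [harg]
      refine (hA.2.1 a 0 θ ha le_rfl hθ0 hθ1).trans ?_
      rw [hA.1, mul_zero, add_zero]
      gcongr
    have hq : 0 < (ρ * δ) ^ (n : ℝ) := Real.rpow_pos_of_pos (by positivity) _
    calc A (a * ρ ^ σ / Λ * g / (ρ * δ) ^ σ) / ENNReal.ofReal ((ρ * δ) ^ (n : ℝ))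
        ≤ ENNReal.ofReal θ * V / ENNReal.ofReal ((ρ * δ) ^ (n : ℝ)) := by gcongr
      _ = V * ENNReal.ofReal (θ / (ρ * δ) ^ (n : ℝ)) := by
          rw [ENNReal.ofReal_div_of_pos hq, mul_comm, mul_div_assoc]
      _ ≤ V * ENNReal.ofReal (C / Λ * (ρ ^ n)⁻¹ * (min δ 1 * δ ^ (-σ - (n : ℝ)))) := by
          gcongr
          rw [div_le_iff₀ hq]
          refine hθle.trans (le_of_eq ?_)
          rw [Real.rpow_sub hδ0, Real.mul_rpow hρ.le hδ0.le, Real.rpow_natCast, Real.rpow_natCast]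
          field_simp
      _ = (ENNReal.ofReal (C / Λ) * V * ENNReal.ofReal ((ρ ^ n)⁻¹)) *
            gagKernel n σ (ρ⁻¹ • x - ρ⁻¹ • y) := by
          rw [gagKernel, ← hδ, ENNReal.ofReal_mul (by positivity), ENNReal.ofReal_mul (by positivity)]
          ring
      _ ≤ _ := by gcongr
  have hΦ := measurable_pairKernel n σ hB
  have hΦx : ∀ x, Measurable fun y => pairKernel n σ B x y := fun x =>
    hΦ.comp (measurable_const.prodMk measurable_id)
  have hΦs : ∀ x : Euc n, Measurable fun y => pairKernel n σ B x (ρ⁻¹ • y) := fun x =>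
    (hΦx x).comp (by fun_prop)
  have hout : Measurable fun x => ∫⁻ y, pairKernel n σ B x y := hΦ.lintegral_prod_right'
  have hout' : Measurable fun x : Euc n => ∫⁻ y, pairKernel n σ B (ρ⁻¹ • x) y :=
    hout.comp (by fun_prop : Measurable fun x : Euc n => ρ⁻¹ • x)
  have hcancel : ENNReal.ofReal ((ρ ^ n)⁻¹) * ENNReal.ofReal (ρ ^ n) = 1 := by
    rw [← ENNReal.ofReal_mul (by positivity), inv_mul_cancel₀ (by positivity), ENNReal.ofReal_one]
  calc Jfun n σ A (fun x i => a * ρ ^ σ * W (ρ⁻¹ • x) i / Λ)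
      ≤ ∫⁻ x : Euc n, ∫⁻ y : Euc n, (ENNReal.ofReal (C / Λ) * V * ENNReal.ofReal ((ρ ^ n)⁻¹)) *
        pairKernel n σ B (ρ⁻¹ • x) (ρ⁻¹ • y) :=
        lintegral_mono fun x => lintegral_mono fun y => hpt x y
    _ = ∫⁻ x : Euc n, (ENNReal.ofReal (C / Λ) * V * ENNReal.ofReal ((ρ ^ n)⁻¹)) *
        (ENNReal.ofReal (ρ ^ n) * ∫⁻ y : Euc n, pairKernel n σ B (ρ⁻¹ • x) y) := by
        refine lintegral_congr fun x => ?_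
        rw [lintegral_const_mul _ (hΦs _), lintegral_comp_inv_smul n ρ hρ _ (hΦx _)]
    _ = ENNReal.ofReal (C / Λ) * V *
        ∫⁻ x : Euc n, ∫⁻ y : Euc n, pairKernel n σ B (ρ⁻¹ • x) y := by
        rw [← lintegral_const_mul _ hout']
        refine lintegral_congr fun x => ?_
        rw [mul_assoc (ENNReal.ofReal (C / Λ) * V), ← mul_assoc (ENNReal.ofReal _), hcancel, one_mul]
    _ = _ := by
        rw [lintegral_comp_inv_smul n ρ hρ _ hout, lintegral_pairKernel n σ hB]
        ring

theorem rcInv_nonneg (A : ℝ → ℝ≥0∞) (v : ℝ≥0∞) : 0 ≤ rcInv A v :=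
  Real.sInf_nonneg fun _ h => h.1

theorem IsYoung.apply_rcInv_le {A : ℝ → ℝ≥0∞} (hA : IsYoung A) (v : ℝ≥0∞) :
    A (rcInv A v) ≤ v := by
  rcases (rcInv_nonneg A v).eq_or_lt with h | h
  · rw [← h, hA.1]
    exact bot_le
  have hev : ∀ᶠ τ in 𝓝[<] rcInv A v, A τ ≤ v := by
    filter_upwards [Ioo_mem_nhdsLT h] with τ hτ
    by_contra! hlt
    exact hτ.2.not_ge (csInf_le ⟨0, fun _ h => h.1⟩ ⟨hτ.1.le, hlt⟩)
  exact le_of_tendsto ((hA.2.2.1 _ h).mono_left (nhdsWithin_mono _ Iio_subset_Iic_self)) hev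

/-- Optimality of `𝓛^{[s],ψ^{[s]}_{s,A}}(ℝⁿ)` as an `[s]`-th order
Campanato target of `V^{s,A}(ℝⁿ)`: any admissible target `φ` satisfies
`r^{{s}} A⁻¹(r^{-n}) ≲ φ(r)`. -/
theorem stmt15 (n : ℕ) (hn : 0 < n) (s : ℝ) (hs1 : 1 < s) (hs2 : ∀ m : ℕ, s ≠ (m : ℝ))
    (hsk : s < (n : ℝ) + (⌊s⌋₊ : ℝ) + 1)
    (A : ℝ → ℝ≥0∞) (hA : IsYoung A) (φ : ℝ → ℝ) (hφ : Admissible φ) (c : ℝ) (hc : 0 < c)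
    (hemb : ∀ (u : Euc n → ℝ) (D : (h : ℕ) → Euc n → (Fin h → Fin n) → ℝ),
      HasWeakDerivs n ⌊s⌋₊ u D →
      fracSem n (s - (⌊s⌋₊ : ℝ)) A (D ⌊s⌋₊) < ⊤ →
      campSemK n ⌊s⌋₊ φ u D ≤ ENNReal.ofReal c * fracSem n (s - (⌊s⌋₊ : ℝ)) A (D ⌊s⌋₊)) :
    ∃ c' : ℝ, 0 < c' ∧ ∀ r : ℝ, 0 < r → psiTop n s A r ≤ c' * φ r := by
  set m := ⌊s⌋₊ with hm
  set σ := s - (m : ℝ) with hσ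
  have hσ0 : 0 < σ :=
    sub_pos.2 (lt_of_le_of_ne (Nat.floor_le (by linarith)) (Ne.symm (hs2 m)))
  have hσ1 : σ < 1 := by
    have := Nat.lt_floor_add_one s
    rw [← hm] at this
    linarith
  have : NeZero n := ⟨hn.ne'⟩
  let b : ContDiffBump (0 : Euc n) := ⟨1, 2, one_pos, one_lt_two⟩
  have hb : ContDiff ℝ (⊤ : ℕ∞) b := b.contDiff
  have hbc : HasCompactSupport b := b.hasCompactSupport
  let W : Euc n → (Fin m → Fin n) → ℝ := fun x d => iterPartial n m b d x
  obtain ⟨C, hC0, hC⟩ := exists_sqrt_sum_sub_sq_le (fun d x => W x d)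
    (fun d => contDiff_iterPartial n m b hb d) (fun d => hasCompactSupport_iterPartial n m b hbc d)
  have hsupp : ∀ x ∉ closedBall (0 : Euc n) 2, ∀ d, W x d = 0 := fun x hx d =>
    image_eq_zero_of_notMem_tsupport (f := iterPartial n m b d) fun h =>
      hx (b.tsupport_eq ▸ tsupport_iterPartial_subset n m b d h)
  set T := (2 * volume (closedBall (0 : Euc n) 2) * ∫⁻ z, gagKernel n σ z) with hT
  have hTtop : T ≠ ⊤ := ENNReal.mul_ne_top
    (ENNReal.mul_ne_top ENNReal.ofNat_ne_top measure_closedBall_lt_top.ne)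
    (lintegral_gagKernel_lt_top n hn σ hσ0 hσ1).ne
  set ω := (volume (ball (0 : Euc n) 1)).toReal with hω
  have hω0 : 0 < ω := ENNReal.toReal_pos (measure_ball_pos _ _ one_pos).ne' measure_ball_lt_top.ne
  have hvol : ∀ ρ : ℝ, 0 < ρ → (volume (ball (0 : Euc n) ρ)).toReal = ρ ^ n * ω := by
    intro ρ hρ
    rw [Measure.addHaar_ball_of_pos _ _ hρ, finrank_euclideanSpace_fin, ENNReal.toReal_mul,
      ENNReal.toReal_ofReal (by positivity)]
  set R : ℝ := 4 * ((m : ℝ) + 1) + 1 with hR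
  have hR0 : 0 < R := by positivity
  set κ : ℝ := ω ^ (-(n : ℝ)⁻¹) / R with hκ
  have hκ0 : 0 < κ := div_pos (Real.rpow_pos_of_pos hω0 _) hR0
  have hκR : (R * κ) ^ n * ω = 1 := by
    rw [hκ, mul_div_cancel₀ _ hR0.ne', ← Real.rpow_natCast, ← Real.rpow_mul hω0.le,
      neg_mul, inv_mul_cancel₀ (by exact_mod_cast hn.ne'), Real.rpow_neg_one,
      inv_mul_cancel₀ hω0.ne']
  set Λ : ℝ := C + C * κ ^ n * T.toReal + 1 with hΛ
  have hCT : 0 ≤ C * κ ^ n * T.toReal := by positivity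
  have hΛ0 : 0 < Λ := by positivity
  set c₀ : ℝ := κ ^ σ * κ ^ m * κ ^ n * ω / 2 ^ (m + 1) with hc₀
  have hκσ : 0 < κ ^ σ := Real.rpow_pos_of_pos hκ0 σ
  have hc₀0 : 0 < c₀ := by positivity
  refine ⟨c * Λ / c₀, by positivity, fun r hr => ?_⟩
  set V := ENNReal.ofReal (r ^ (-(n : ℝ))) with hV
  set a := rcInv A V with ha
  have ha0 : 0 ≤ a := rcInv_nonneg A V
  set ρ := κ * r with hρ
  have hρ0 : 0 < ρ := mul_pos hκ0 hr
  set α := a * ρ ^ σ * ρ ^ m with hα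
  let u : Euc n → ℝ := fun y => α * b (ρ⁻¹ • y)
  have hu : ContDiff ℝ (⊤ : ℕ∞) u :=
    contDiff_const.mul (hb.comp (contDiff_const_smul ρ⁻¹))
  have huc : HasCompactSupport u :=
    (hbc.comp_smul (inv_ne_zero hρ0.ne')).mul_left
  have hD := hasWeakDerivs_iterPartial n m u hu huc
  have hDm : (fun x (d : Fin m → Fin n) => iterPartial n m u d x / Λ) =
      fun x d => a * ρ ^ σ * W (ρ⁻¹ • x) d / Λ := by
    funext x d
    congr 1
    refine (iterPartial_comp_smul n m b hb α ρ⁻¹ d x).trans ?_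
    rw [hα, mul_assoc (a * ρ ^ σ), ← mul_pow, mul_inv_cancel₀ hρ0.ne', one_pow, mul_one]
  have hJ : Jfun n σ A (fun x (d : Fin m → Fin n) => iterPartial n m u d x / Λ) ≤ 1 := by
    rw [hDm]
    refine (Jfun_scaled_le n σ hσ0 hσ1 W isClosed_closedBall.measurableSet hsupp C hC0 hC A hA V a
      ha0 (hA.apply_rcInv_le V) ρ hρ0 Λ hΛ0 (by linarith)).trans ?_
    rw [← hT, ← ENNReal.ofReal_toReal hTtop, hV, ← ENNReal.ofReal_mul (by positivity),
      ← ENNReal.ofReal_mul (by positivity), ← ENNReal.ofReal_mul (by positivity),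
      ← ENNReal.ofReal_one]
    refine ENNReal.ofReal_le_ofReal ?_
    rw [Real.rpow_neg hr.le, Real.rpow_natCast, hρ, mul_pow]
    have : C / Λ * (r ^ n)⁻¹ * (κ ^ n * r ^ n) * T.toReal = C * κ ^ n * T.toReal / Λ := by
      field_simp
    rw [this, div_le_one hΛ0]
    linarith
  have hfrac : fracSem n σ A (fun x (d : Fin m → Fin n) => iterPartial n m u d x) ≤
      ENNReal.ofReal Λ := sInf_le ⟨Λ, ⟨hΛ0, hJ⟩, rfl⟩
  have hcamp := (hemb u _ hD (hfrac.trans_lt ENNReal.ofReal_lt_top)).trans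
    (mul_le_mul_right hfrac (ENNReal.ofReal c))
  have hvolR : (volume (ball (0 : Euc n) (R * ρ))).toReal = r ^ n := by
    rw [hvol _ (by positivity), hρ, ← mul_assoc, mul_pow, mul_right_comm, hκR, one_mul]
  have hφr := hφ.1 r hr
  have hlow : ENNReal.ofReal ((φ r * r ^ m)⁻¹ * ((r ^ n)⁻¹ * (α * (ρ ^ n * ω) / 2 ^ (m + 1)))) ≤
      oscQuotK n m φ u (fun h x d => iterPartial n h u d x) 0 (R * ρ) := by
    refine le_iInf₂ fun P hP => ENNReal.ofReal_le_ofReal ?_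
    have hroot : (r ^ n) ^ ((n : ℝ)⁻¹) = r := Real.pow_rpow_inv_natCast hr.le hn.ne'
    have hrootm : (r ^ n) ^ ((m : ℝ) / (n : ℝ)) = r ^ m := by
      rw [div_eq_inv_mul, Real.rpow_mul (by positivity), hroot, Real.rpow_natCast]
    rw [hvolR, hroot, hrootm, setAverage_eq, Measure.real, hvolR, smul_eq_mul]
    gcongr
    rw [div_le_iff₀ (by positivity), ← hvol ρ hρ0, mul_comm _ (2 ^ (m + 1))]
    let v : Euc n := EuclideanSpace.single ⟨0, hn⟩ (4 * ρ)
    have hv : ‖v‖ = 4 * ρ := by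
      simp [v, abs_of_pos hρ0]
    have hjv : ∀ j : ℕ, ‖(j : ℝ) • v‖ = j * (4 * ρ) := fun j => by
      rw [norm_smul, hv, Real.norm_natCast]
    refine le_setIntegral_abs_sub_eval n m u hu.continuous P hP.1 v α ρ (R * ρ) ?_ ?_ ?_
    · intro x hx
      have h1 : b (ρ⁻¹ • x) = 1 := b.one_of_mem_closedBall (by
        rw [mem_ball_zero_iff] at hx
        rw [mem_closedBall_zero_iff, norm_smul, norm_inv, Real.norm_eq_abs, abs_of_pos hρ0,
          inv_mul_le_iff₀ hρ0]
        change ‖x‖ ≤ ρ * 1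
        linarith)
      simp only [u, h1, mul_one]
    · intro x hx j hj
      have h0 : b (ρ⁻¹ • (x + (j : ℝ) • v)) = 0 := b.zero_of_le_dist (by
        rw [mem_ball_zero_iff] at hx
        rw [dist_zero_right, norm_smul, norm_inv, Real.norm_eq_abs, abs_of_pos hρ0,
          le_inv_mul_iff₀ hρ0]
        change ρ * 2 ≤ _
        have h1 := norm_sub_le (x + (j : ℝ) • v) x
        rw [add_sub_cancel_left, hjv] at h1
        have h2 : (1 : ℝ) ≤ j := by exact_mod_cast hj
        nlinarith)
      simp only [u, h0, mul_zero]
    · intro x hx j hj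
      rw [mem_ball_zero_iff] at hx ⊢
      have h1 := norm_add_le x ((j : ℝ) • v)
      rw [hjv] at h1
      have h2 : (j : ℝ) ≤ m + 1 := by exact_mod_cast hj
      rw [hR]
      nlinarith
  have hsup : oscQuotK n m φ u (fun h x d => iterPartial n h u d x) 0 (R * ρ) ≤
      campSemK n m φ u (fun h x d => iterPartial n h u d x) := by
    refine le_iSup_of_le (0 : Euc n) (le_iSup_of_le (R * ρ) ?_)
    exact le_iSup (fun _ : 0 < R * ρ => oscQuotK n m φ u (fun h x d => iterPartial n h u d x) 0
      (R * ρ)) (mul_pos hR0 hρ0)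
  have hfinal := (hlow.trans hsup).trans hcamp
  rw [← ENNReal.ofReal_mul hc.le, ENNReal.ofReal_le_ofReal_iff (by positivity)] at hfinal
  have hpsi : psiTop n s A r = r ^ σ * a := rfl
  have hval : (φ r * r ^ m)⁻¹ * ((r ^ n)⁻¹ * (α * (ρ ^ n * ω) / 2 ^ (m + 1))) =
      c₀ * (r ^ σ * a) / φ r := by
    rw [hα, hc₀, hρ, Real.mul_rpow hκ0.le hr.le, mul_pow, mul_pow]
    field_simp
  rw [hval, div_le_iff₀ hφr] at hfinal
  rw [hpsi, div_mul_eq_mul_div, le_div_iff₀ hc₀0]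
  linarith
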